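/- For all r ≥ 0 and j ≥ 0, the exponential generating function ∑_{n≥0} p^r_j(n) x^n/n! equals e^{rx}/(2 − e^x)^j as formal power series over ℚ, where p^r_j(n) := ∑_{s=0}^{n} C(n,s) · J^{j−1}_s · r^{n−s} for j ≥ 1 (and p^r_0(n) := r^n). -/

import Mathlib

/-- Stirling numbers of the second kind. -/
def stirling : ℕ → ℕ → ℕ
  | 0, 0 => 1
  | 0, _ + 1 => 0
  | _ + 1, 0 => 0
  | n + 1, s + 1 => (s + 1) * stirling n (s + 1) + stirling n s

/-- `J k n`: the number of barred preferential arrangements of an `n`-set with `k` bars,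
given by its closed form `∑ S(n,s)·s!·C(k+s,s)`. -/
def J (k n : ℕ) : ℕ :=
  ∑ s ∈ Finset.range (n + 1), stirling n s * s.factorial * (k + s).choose s

/-- `P r j n`: barred preferential arrangements of an `n`-set with `r + j - 1` bars,
with `r` restricted sections and `j` free sections. -/
def P (r : ℕ) : ℕ → ℕ → ℕ
  | 0, n => r ^ n
  | j + 1, n => ∑ s ∈ Finset.range (n + 1), n.choose s * J j s * r ^ (n - s)

open PowerSeries in
theorem coeff_exp_sub_one_pow (n d : ℕ) :
    coeff n ((exp ℚ - 1) ^ d) = (stirling n d * d.factorial : ℚ) / n.factorial := by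
  induction n generalizing d with
  | zero => cases d <;> simp [stirling]
  | succ n ih =>
    cases d with
    | zero => simp [stirling, coeff_one]
    | succ d =>
      have hD : d⁄dX ℚ ((exp ℚ - 1) ^ (d + 1)) =
          ((d + 1 : ℕ) : ℚ) • ((exp ℚ - 1) ^ (d + 1) + (exp ℚ - 1) ^ d) := by
        rw [derivative_pow, map_sub, derivative_exp, derivative_one, Nat.add_sub_cancel,
          Nat.cast_smul_eq_nsmul, nsmul_eq_mul]
        ring
      have h := congrArg (coeff n) hD
      rw [coeff_derivative, coeff_smul, map_add, ih, ih] at h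
      rw [← mul_left_inj' (n.cast_add_one_ne_zero (R := ℚ)), h]
      simp only [stirling, Nat.factorial_succ, smul_eq_mul]
      push_cast
      field_simp

theorem stirling_eq_zero_of_lt {n d : ℕ} (h : n < d) : stirling n d = 0 := by
  induction n generalizing d with
  | zero => cases d <;> simp_all [stirling]
  | succ n ih =>
    cases d with
    | zero => omega
    | succ d => simp [stirling, ih (show n < d by omega), ih (show n < d + 1 by omega)]

open PowerSeries in
/-- The exponential generating function of `J k` is `(2 - exp)⁻¹ ^ (k + 1)`. -/
theorem mk_J_div_factorial (k : ℕ) :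
    PowerSeries.mk (fun n => (J k n : ℚ) / n.factorial) = ((2 - exp ℚ)⁻¹) ^ (k + 1) := by
  have hs : HasSubst (exp ℚ - 1) := HasSubst.of_constantCoeff_zero' (by simp)
  have hJ : PowerSeries.mk (fun n => (J k n : ℚ) / n.factorial) =
      substAlgHom (R := ℚ) hs (invOneSubPow ℚ (k + 1)).val := by
    ext n
    rw [coe_substAlgHom, coeff_subst' hs, coeff_mk, invOneSubPow_val_succ_eq_mk_add_choose,
      finsum_eq_sum_of_support_subset (s := Finset.range (n + 1))]
    · simp only [J, coeff_mk, coeff_exp_sub_one_pow, smul_eq_mul]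
      push_cast
      rw [Finset.sum_div]
      refine Finset.sum_congr rfl fun d _ => ?_
      rw [Nat.choose_symm_add]
      ring
    · intro d hd
      by_contra hlt
      refine hd ?_
      simp only [Finset.coe_range, Set.mem_Iio, not_lt] at hlt
      simp [coeff_exp_sub_one_pow, stirling_eq_zero_of_lt (show n < d by omega)]
  have hinv : (2 - exp ℚ) * (2 - exp ℚ)⁻¹ = 1 :=
    PowerSeries.mul_inv_cancel _ (by norm_num [map_sub, map_ofNat])
  have hmul : substAlgHom (R := ℚ) hs (invOneSubPow ℚ (k + 1)).val * (2 - exp ℚ) ^ (k + 1) = 1 := by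
    have h := congrArg (substAlgHom (R := ℚ) hs) (invOneSubPow ℚ (k + 1)).val_inv
    rw [invOneSubPow_inv_eq_one_sub_pow, map_mul, map_pow, map_sub, map_one, substAlgHom_X] at h
    rwa [show (1 : ℚ⟦X⟧) - (exp ℚ - 1) = 2 - exp ℚ by ring] at h
  rw [hJ]
  calc _ = _ * ((2 - exp ℚ) * (2 - exp ℚ)⁻¹) ^ (k + 1) := by rw [hinv, one_pow, mul_one]
    _ = _ := by rw [mul_pow, ← mul_assoc, hmul, one_mul]

open PowerSeries in
theorem mk_pow_div_factorial (r : ℕ) :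
    PowerSeries.mk (fun n => (r : ℚ) ^ n / n.factorial) = exp ℚ ^ r := by
  ext n
  simp [exp_pow_eq_rescale_exp, div_eq_mul_inv]

theorem stmt_10 (r j : ℕ) :
    PowerSeries.mk (fun n => (P r j n : ℚ) / n.factorial) =
      (PowerSeries.exp ℚ) ^ r * ((2 - PowerSeries.exp ℚ)⁻¹) ^ j := by
  cases j with
  | zero => simp [P, ← mk_pow_div_factorial]
  | succ k =>
    rw [← mk_J_div_factorial, ← mk_pow_div_factorial, mul_comm]
    ext n
    rw [PowerSeries.coeff_mul, Finset.Nat.sum_antidiagonal_eq_sum_range_succ_mk]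
    simp only [PowerSeries.coeff_mk, P]
    push_cast
    rw [Finset.sum_div]
    refine Finset.sum_congr rfl fun s hs => ?_
    rw [Nat.cast_choose ℚ (Finset.mem_range_succ_iff.1 hs)]
    field_simp
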